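/- arXiv:1912.07141 — 6 statements merged into one kernel-verified Lean document; each statement's English description precedes it below -/
import Mathlib

section
/- Let (G,·,0) be a BCI-algebra and let (H,∘) be the A-holomorph of (G,·) with zero element (id,0). Then (H,∘,(id,0)) is a BCI-algebra if and only if ((δ(x)·δ(y))·(x·γ(z)))·(z·y) = 0 for all x,y,z ∈ G and all δ,γ ∈ A. -/
def IsBCI {G : Type*} (op : G → G → G) (e : G) : Prop :=
  (∀ x y z, op (op (op x y) (op x z)) (op z y) = e) ∧
  (∀ x, op x e = x) ∧
  (∀ x y, op x y = e → op y x = e → x = y)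

/-- The operation of the `A`-holomorph of `(G, op)`:
`(α,x)∘(β,y) = (αβ, β(x)·y)`. -/
def holOp {G : Type*} (op : G → G → G) (A : Subgroup (Equiv.Perm G)) :
    A × G → A × G → A × G :=
  fun p q => (p.1 * q.1, op ((q.1 : Equiv.Perm G) p.2) q.2)

theorem IsBCI.op_self {G : Type*} {op : G → G → G} {e : G} (h : IsBCI op e) (x : G) :
    op x x = e := by
  simpa only [h.2.1] using h.1 x e e

theorem IsBCI.map_zero {G : Type*} {op : G → G → G} {e : G} (h : IsBCI op e)
    {φ : G → G} (hφ : ∀ x y, φ (op x y) = op (φ x) (φ y)) : φ e = e := by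
  rw [← h.op_self e, hφ, h.op_self, h.op_self]

theorem holomorph_BCI_iff {G : Type*} (op : G → G → G) (e : G)
    (A : Subgroup (Equiv.Perm G))
    (hAut : ∀ φ : Equiv.Perm G, φ ∈ A → ∀ x y : G, φ (op x y) = op (φ x) (φ y))
    (hBool : ∀ φ : Equiv.Perm G, φ ∈ A → φ * φ = 1)
    (hG : IsBCI op e) :
    IsBCI (holOp op A) ((1 : A), e) ↔
      (∀ δ : Equiv.Perm G, δ ∈ A → ∀ γ : Equiv.Perm G, γ ∈ A → ∀ x y z : G, op (op (op (δ x) (δ y)) (op x (γ z))) (op z y) = e) := by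
  have invol : ∀ φ ∈ A, ∀ x, φ (φ x) = x := fun φ hφ x => by
    rw [← Equiv.Perm.mul_apply, hBool φ hφ, Equiv.Perm.one_apply]
  constructor
  · intro h δ hδ γ hγ x y z
    have key := congrArg Prod.snd (h.1 (⟨δ, hδ⟩, x) (1, y) (⟨γ, hγ⟩, z))
    have comm : γ (δ (γ (op x y))) = δ (op x y) := by
      have hδγ := invol _ (A.mul_mem hδ hγ) (op x y)
      simp only [Equiv.Perm.mul_apply] at hδγ
      rw [← invol δ hδ (γ (δ (γ (op x y)))), hδγ]
    simpa [holOp, hAut γ hγ (δ _), hAut γ hγ (op _ _), hAut γ hγ (γ _), comm, invol γ hγ,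
      hAut δ hδ] using key
  · intro h
    have op_apply : ∀ φ ∈ A, ∀ x, op (φ x) x = e := fun φ hφ x => by
      simpa [hG.map_zero (hAut φ hφ), hG.2.1] using h φ hφ 1 A.one_mem x e e
    have eq_one : ∀ φ ∈ A, φ = 1 := fun φ hφ => by
      ext x
      refine hG.2.2 _ _ (op_apply φ hφ x) ?_
      simpa only [invol φ hφ, Equiv.Perm.one_apply] using op_apply φ hφ (φ x)
    have fst_eq : ∀ a : A, a = 1 := fun a => Subtype.ext (eq_one a a.2)
    refine ⟨?_, ?_, ?_⟩
    · rintro ⟨a, x⟩ ⟨b, y⟩ ⟨c, z⟩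
      simp [holOp, fst_eq a, fst_eq b, fst_eq c, hG.1]
    · rintro ⟨a, x⟩
      simp [holOp, hG.2.1]
    · rintro ⟨a, x⟩ ⟨b, y⟩ hxy hyx
      rw [fst_eq a, fst_eq b] at hxy hyx ⊢
      exact congrArg (Prod.mk 1)
        (hG.2.2 x y (congrArg Prod.snd hxy) (congrArg Prod.snd hyx))
end

section
/- Let (G,·) be a set with a binary operation and a distinguished element 0, and let (H,∘) be the A-holomorph of (G,·). Then (H,∘,(id,0)) is a BCI-algebra if and only if (G,·,0) is a BCI-algebra and ((δ(x)·δ(y))·(x·γ(z)))·(z·y) = 0 for all x,y,z ∈ G and all δ,γ ∈ A. -/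
/-- Under the holomorph identity, every automorphism in `A` fixes every element. -/
theorem IsBCI.apply_eq_self {G : Type*} {op : G → G → G} {e : G} (h : IsBCI op e)
    {A : Subgroup (Equiv.Perm G)}
    (hAut : ∀ φ : Equiv.Perm G, φ ∈ A → ∀ x y : G, φ (op x y) = op (φ x) (φ y))
    (hBool : ∀ φ : Equiv.Perm G, φ ∈ A → φ * φ = 1)
    (hId : ∀ δ : Equiv.Perm G, δ ∈ A → ∀ γ : Equiv.Perm G, γ ∈ A → ∀ x y z : G,
      op (op (op (δ x) (δ y)) (op x (γ z))) (op z y) = e)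
    {φ : Equiv.Perm G} (hφ : φ ∈ A) (x : G) : φ x = x := by
  have he : φ e = e := by
    have h1 := hAut φ hφ e e
    rwa [h.op_self, h.op_self] at h1
  have key (u : G) : op (φ u) u = e := by
    have h1 := hId φ hφ φ hφ u e e
    simpa only [he, h.2.1] using h1
  have hinv : φ (φ x) = x := Equiv.congr_fun (hBool φ hφ) x
  refine h.2.2 _ _ (key x) ?_
  simpa only [hinv] using key (φ x)

theorem holomorph_BCI_iff' {G : Type*} (op : G → G → G) (e : G)
    (A : Subgroup (Equiv.Perm G))
    (hAut : ∀ φ : Equiv.Perm G, φ ∈ A → ∀ x y : G, φ (op x y) = op (φ x) (φ y))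
    (hBool : ∀ φ : Equiv.Perm G, φ ∈ A → φ * φ = 1) :
    IsBCI (holOp op A) ((1 : A), e) ↔
      (IsBCI op e ∧
        (∀ δ : Equiv.Perm G, δ ∈ A → ∀ γ : Equiv.Perm G, γ ∈ A → ∀ x y z : G, op (op (op (δ x) (δ y)) (op x (γ z))) (op z y) = e)) := by
  constructor
  · rintro ⟨h1, h2, h3⟩
    refine ⟨⟨fun x y z => ?_, fun x => ?_, fun x y hxy hyx => ?_⟩, fun δ hδ γ hγ x y z => ?_⟩
    · simpa [holOp] using congrArg Prod.snd (h1 (1, x) (1, y) (1, z))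
    · simpa [holOp] using congrArg Prod.snd (h2 (1, x))
    · exact congrArg Prod.snd
        (h3 (1, x) (1, y) (by simp [holOp, hxy]) (by simp [holOp, hyx]))
    · have hinv (u : G) : γ (γ u) = u := Equiv.congr_fun (hBool γ hγ) u
      have hcomm (u : G) : γ (δ (γ u)) = δ u := by
        have h4 : δ (γ (δ (γ u))) = u :=
          Equiv.congr_fun (hBool _ (A.mul_mem hδ hγ)) u
        have h5 : δ (δ (γ (δ (γ u)))) = γ (δ (γ u)) := Equiv.congr_fun (hBool δ hδ) _
        rw [← h5, h4]
      simpa [holOp, hAut δ hδ, hAut γ hγ, hinv, hcomm] using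
        congrArg Prod.snd (h1 (⟨δ, hδ⟩, x) (1, y) (⟨γ, hγ⟩, z))
  · rintro ⟨h, hId⟩
    have fix (φ : A) (x : G) : (φ : Equiv.Perm G) x = x :=
      h.apply_eq_self hAut hBool hId φ.2 x
    have triv (φ : A) : φ = 1 := Subtype.ext (Equiv.ext (fix φ))
    refine ⟨fun p q r => Prod.ext (triv _) ?_, fun p => Prod.ext ?_ ?_, fun p q hpq hqp =>
      Prod.ext ((triv _).trans (triv _).symm) (h.2.2 _ _ ?_ ?_)⟩
    · simpa only [holOp, fix] using h.1 p.2 q.2 r.2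
    · exact mul_one p.1
    · exact h.2.1 p.2
    · simpa only [holOp, fix] using congrArg Prod.snd hpq
    · simpa only [holOp, fix] using congrArg Prod.snd hqp
end

section
/- Let (G,·) be a set with a binary operation and a distinguished element 0, and let (H,∘) be the A-holomorph of (G,·). Then (H,∘,(id,0)) is a BCK-algebra if and only if (G,·,0) is a BCK-algebra and ((δ(x)·δ(y))·(x·γ(z)))·(z·y) = 0 for all x,y,z ∈ G and all δ,γ ∈ A. -/
def IsBCK {G : Type*} (op : G → G → G) (e : G) : Prop :=
  IsBCI op e ∧ ∀ x, op e x = e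

/-- The holomorph over the trivial group is a copy of the original algebra. -/
theorem isBCK_holOp_bot_iff {G : Type*} (op : G → G → G) (e : G) :
    IsBCK (holOp op ⊥) (1, e) ↔ IsBCK op e := by
  have hop (a b : (⊥ : Subgroup (Equiv.Perm G))) (x y : G) :
      holOp op ⊥ (a, x) (b, y) = (1, op x y) := by
    obtain rfl := Subsingleton.elim a 1
    obtain rfl := Subsingleton.elim b 1
    simp [holOp]
  have huniq (a : (⊥ : Subgroup (Equiv.Perm G))) : a = 1 := Subsingleton.elim a 1
  simp [IsBCK, IsBCI, hop, huniq]

theorem eq_bot_of_isBCK_holOp {G : Type*} {op : G → G → G} {e : G}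
    {A : Subgroup (Equiv.Perm G)} (h : IsBCK (holOp op A) (1, e)) : A = ⊥ := by
  rw [Subgroup.eq_bot_iff_forall]
  intro φ hφ
  simpa [holOp] using congrArg Prod.fst (h.2 (⟨φ, hφ⟩, e))

theorem holomorph_BCK_iff {G : Type*} (op : G → G → G) (e : G)
    (A : Subgroup (Equiv.Perm G))
    (hAut : ∀ φ : Equiv.Perm G, φ ∈ A → ∀ x y : G, φ (op x y) = op (φ x) (φ y))
    (hBool : ∀ φ : Equiv.Perm G, φ ∈ A → φ * φ = 1) :
    IsBCK (holOp op A) ((1 : A), e) ↔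
      (IsBCK op e ∧
        (∀ δ : Equiv.Perm G, δ ∈ A → ∀ γ : Equiv.Perm G, γ ∈ A → ∀ x y z : G, op (op (op (δ x) (δ y)) (op x (γ z))) (op z y) = e)) := by
  constructor
  · intro h
    obtain rfl := eq_bot_of_isBCK_holOp h
    have hG := (isBCK_holOp_bot_iff op e).1 h
    refine ⟨hG, fun δ hδ γ hγ x y z => ?_⟩
    obtain rfl := Subgroup.mem_bot.1 hδ
    obtain rfl := Subgroup.mem_bot.1 hγ
    exact hG.1.1 x y z
  · rintro ⟨hG, hA⟩
    have hle (δ : Equiv.Perm G) (hδ : δ ∈ A) (x : G) : op (δ x) x = e := by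
      have hδe : δ e = e := by
        rw [← hG.1.op_self e, hAut δ hδ, hG.1.op_self, hG.1.op_self]
      simpa [hG.1.2.1, hδe] using hA δ hδ 1 A.one_mem x e e
    have hbot : A = ⊥ := by
      rw [Subgroup.eq_bot_iff_forall]
      intro δ hδ
      ext x
      refine hG.1.2.2 _ _ (hle δ hδ x) ?_
      have hinv : δ (δ x) = x := DFunLike.congr_fun (hBool δ hδ) x
      simpa only [hinv, Equiv.Perm.one_apply] using hle δ hδ (δ x)
    subst hbot
    exact (isBCK_holOp_bot_iff op e).2 hG
end

section
/- Let (G,·,0) be a BCI-algebra whose A-holomorph (H,∘,(id,0)) is also a BCI-algebra. Then the operation ∘ on H is associative if and only if the operation · on G is associative. -/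
theorem holomorph_assoc_iff {G : Type*} (op : G → G → G) (e : G)
    (A : Subgroup (Equiv.Perm G))
    (hAut : ∀ φ : Equiv.Perm G, φ ∈ A → ∀ x y : G, φ (op x y) = op (φ x) (φ y))
    (hBool : ∀ φ : Equiv.Perm G, φ ∈ A → φ * φ = 1)
    (hG : IsBCI op e) (hH : IsBCI (holOp op A) ((1 : A), e)) :
    (∀ u v w : A × G, holOp op A (holOp op A u v) w = holOp op A u (holOp op A v w)) ↔
      (∀ x y z : G, op (op x y) z = op x (op y z)) := by
  constructor
  · intro h x y z
    simpa [holOp] using congrArg Prod.snd (h (1, x) (1, y) (1, z))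
  · rintro h ⟨α, x⟩ ⟨β, y⟩ ⟨γ, z⟩
    have inv_eq : ∀ φ : A, φ⁻¹ = φ := fun φ =>
      inv_eq_of_mul_eq_one_left (Subtype.ext (hBool φ φ.2))
    have comm : γ * β = β * γ := by
      rw [← inv_eq (γ * β), mul_inv_rev, inv_eq, inv_eq]
    have comm_apply : (γ : Equiv.Perm G) ((β : Equiv.Perm G) x) =
        (β : Equiv.Perm G) ((γ : Equiv.Perm G) x) :=
      congrArg (fun φ : A => (φ : Equiv.Perm G) x) comm
    simp [holOp, mul_assoc, hAut γ γ.2, h, comm_apply]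
end

section
/- Let (G,·) be a set with a binary operation and a distinguished element 0, and let (H,∘) be the A-holomorph of (G,·). Then (H,∘,(id,0)) is an associative BCI-algebra if and only if (G,·,0) is an associative BCI-algebra and ((δ(x)·δ(y))·(x·γ(z)))·(z·y) = 0 for all x,y,z ∈ G and all δ,γ ∈ A. -/
theorem holOp_mk {G : Type*} (op : G → G → G) (A : Subgroup (Equiv.Perm G))
    (α β : A) (x y : G) :
    holOp op A (α, x) (β, y) = (α * β, op ((β : Equiv.Perm G) x) y) := rfl

/-- The compatibility condition forces every member of `A` to act trivially. -/
theorem apply_eq_self_of_condition {G : Type*} {op : G → G → G} {e : G}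
    {A : Subgroup (Equiv.Perm G)}
    (hAut : ∀ φ : Equiv.Perm G, φ ∈ A → ∀ x y : G, φ (op x y) = op (φ x) (φ y))
    (hBool : ∀ φ : Equiv.Perm G, φ ∈ A → φ * φ = 1)
    (h : IsBCI op e)
    (hC : ∀ δ : Equiv.Perm G, δ ∈ A → ∀ γ : Equiv.Perm G, γ ∈ A → ∀ x y z : G,
      op (op (op (δ x) (δ y)) (op x (γ z))) (op z y) = e)
    {δ : Equiv.Perm G} (hδ : δ ∈ A) (x : G) : δ x = x := by
  obtain ⟨-, hid, hanti⟩ := h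
  have key : ∀ x, op (δ x) x = e := fun x => by
    simpa [← hAut δ hδ, hid] using hC δ hδ 1 A.one_mem x e e
  have hinv : δ (δ x) = x := by
    rw [← Equiv.Perm.mul_apply, hBool δ hδ, Equiv.Perm.one_apply]
  exact hanti _ _ (key x) (by simpa [hinv] using key (δ x))

theorem holomorph_assoc_BCI_iff {G : Type*} (op : G → G → G) (e : G)
    (A : Subgroup (Equiv.Perm G))
    (hAut : ∀ φ : Equiv.Perm G, φ ∈ A → ∀ x y : G, φ (op x y) = op (φ x) (φ y))
    (hBool : ∀ φ : Equiv.Perm G, φ ∈ A → φ * φ = 1) :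
    (IsBCI (holOp op A) ((1 : A), e) ∧
        (∀ u v w : A × G, holOp op A (holOp op A u v) w = holOp op A u (holOp op A v w))) ↔
      ((IsBCI op e ∧ (∀ x y z : G, op (op x y) z = op x (op y z))) ∧
        (∀ δ : Equiv.Perm G, δ ∈ A → ∀ γ : Equiv.Perm G, γ ∈ A → ∀ x y z : G, op (op (op (δ x) (δ y)) (op x (γ z))) (op z y) = e)) := by
  constructor
  · rintro ⟨⟨hbci, hid, hanti⟩, hassoc⟩
    have hC : ∀ δ : Equiv.Perm G, δ ∈ A → ∀ γ : Equiv.Perm G, γ ∈ A → ∀ x y z : G,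
        op (op (op (δ x) (δ y)) (op x (γ z))) (op z y) = e := by
      intro δ hδ γ hγ x y z
      have hinv : ∀ w, γ (γ w) = w := fun w => by
        rw [← Equiv.Perm.mul_apply, hBool γ hγ, Equiv.Perm.one_apply]
      have hcomm : ∀ w, γ (δ (γ w)) = δ w := fun w => by
        have h := hBool (γ * δ) (A.mul_mem hγ hδ)
        have h' := congrArg (fun f : Equiv.Perm G => f (δ w)) h
        have hd : δ (δ w) = w := by
          rw [← Equiv.Perm.mul_apply, hBool δ hδ, Equiv.Perm.one_apply]
        simpa [hd] using h'
      have h := congrArg Prod.snd (hbci (⟨δ, hδ⟩, x) (1, y) (⟨γ, hγ⟩, z))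
      simpa [holOp_mk, hAut γ hγ, hAut δ hδ, hinv, hcomm] using h
    refine ⟨⟨⟨fun x y z => ?_, fun x => ?_, fun x y hxy hyx => ?_⟩, fun x y z => ?_⟩, hC⟩
    · simpa using hC 1 A.one_mem 1 A.one_mem x y z
    · simpa [holOp_mk] using hid (1, x)
    · simpa using hanti (1, x) (1, y) (by simp [holOp_mk, hxy]) (by simp [holOp_mk, hyx])
    · simpa [holOp_mk] using hassoc (1, x) (1, y) (1, z)
  · rintro ⟨⟨h, hassoc⟩, hC⟩
    have htriv : ∀ (α : A) (x : G), (α : Equiv.Perm G) x = x :=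
      fun α => apply_eq_self_of_condition hAut hBool h hC α.2
    obtain ⟨hbci, hid, hanti⟩ := h
    have hone : ∀ α : A, α = 1 := fun α => Subtype.ext (Equiv.ext (htriv α))
    refine ⟨⟨?_, ?_, ?_⟩, ?_⟩
    · rintro ⟨α, x⟩ ⟨β, y⟩ ⟨γ, z⟩
      simp [holOp_mk, hone α, hone β, hone γ, hbci]
    · rintro ⟨α, x⟩
      simp [holOp_mk, hid]
    · rintro ⟨α, x⟩ ⟨β, y⟩ hxy hyx
      simp only [holOp_mk, htriv, Prod.mk.injEq] at hxy hyx
      rw [hone α, hone β, hanti x y hxy.2 hyx.2]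
    · rintro ⟨α, x⟩ ⟨β, y⟩ ⟨γ, z⟩
      simp [holOp_mk, htriv, hassoc, mul_assoc]
end

section
/- Let (G,·,0) be a BCI-algebra whose A-holomorph (H,∘,(id,0)) is also a BCI-algebra. Then (H,∘) satisfies the identity F₄₂, namely (u∘u)∘(v∘w) = ((u∘u)∘v)∘w for all u,v,w ∈ H, if and only if (G,·) satisfies F₄₂, namely (x·x)·(y·z) = ((x·x)·y)·z for all x,y,z ∈ G. -/
def F42 {X : Type*} (m : X → X → X) : Prop :=
  ∀ x y z : X, m (m x x) (m y z) = m (m (m x x) y) z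

theorem IsBCI.op_self_s16 {X : Type*} {m : X → X → X} {o : X} (h : IsBCI m o) (x : X) :
    m x x = o := by
  have h₁ := h.1 x o o
  rwa [h.2.1 x, h.2.1 o, h.2.1 (m x x)] at h₁

/-- If the `A`-holomorph of a BCI-algebra is a BCI-algebra, then `A` acts trivially. -/
theorem apply_eq_self_of_isBCI_holOp {G : Type*} {op : G → G → G} {e : G}
    {A : Subgroup (Equiv.Perm G)}
    (hAut : ∀ φ : Equiv.Perm G, φ ∈ A → ∀ x y : G, φ (op x y) = op (φ x) (φ y))
    (hBool : ∀ φ : Equiv.Perm G, φ ∈ A → φ * φ = 1)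
    (hG : IsBCI op e) (hH : IsBCI (holOp op A) ((1 : A), e)) (α : A) (x : G) :
    (α : Equiv.Perm G) x = x := by
  have map_zero : (α : Equiv.Perm G) e = e := by
    have h := hAut α α.2 e e
    rwa [hG.op_self_s16, hG.op_self_s16] at h
  have left : op ((α : Equiv.Perm G) x) x = e :=
    congrArg Prod.snd (hH.op_self_s16 (α, x))
  have invol : (α : Equiv.Perm G) ((α : Equiv.Perm G) x) = x :=
    congrArg (fun φ : Equiv.Perm G => φ x) (hBool α α.2)
  have right := hAut α α.2 ((α : Equiv.Perm G) x) x
  rw [left, invol, map_zero] at right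
  exact hG.2.2 _ _ left right.symm

theorem holomorph_F42_iff {G : Type*} (op : G → G → G) (e : G)
    (A : Subgroup (Equiv.Perm G))
    (hAut : ∀ φ : Equiv.Perm G, φ ∈ A → ∀ x y : G, φ (op x y) = op (φ x) (φ y))
    (hBool : ∀ φ : Equiv.Perm G, φ ∈ A → φ * φ = 1)
    (hG : IsBCI op e) (hH : IsBCI (holOp op A) ((1 : A), e)) :
    (F42 (holOp op A) ↔ F42 op) := by
  have triv := apply_eq_self_of_isBCI_holOp hAut hBool hG hH
  constructor
  · intro h x y z
    simpa only [holOp, triv] using congrArg Prod.snd (h (1, x) (1, y) (1, z))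
  · rintro h ⟨α, x⟩ ⟨β, y⟩ ⟨γ, z⟩
    simp only [holOp, triv, mul_assoc, h x y z]
end
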